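/- arXiv:1907.07934 — 2 statements merged into one kernel-verified Lean document; each statement's English description precedes it below -/
import Mathlib

section
/- Let X be a Polish space (the paper allows more generally Suslin spaces) and let φ₁,…,φ_n : X → ℝ be bounded measurable functions. Set A* = {μ ∈ P(X) : ∫ φ_j dμ ≤ 0 for j = 1,…,n} and let Δ*(n) be the set of measures in A* that are convex combinations of at most n+1 Dirac masses. Then for every μ ∈ A* there exists a Borel probability measure ν on P(X) with ν(Δ*(n)) = 1 such that μ is the barycenter of ν, i.e. for every bounded continuous φ : X → ℝ one has ∫_X φ dμ = ∫_{P(X)} (∫_X φ ds) dν(s). -/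
open MeasureTheory
open scoped ENNReal

/-- If more than `finrank E + 1` weights are nonzero, they can be modified without increasing the
cost so that fewer of them are nonzero. -/
lemma exists_weights_card_support_lt {ι E : Type*} [Fintype ι] [AddCommGroup E] [Module ℝ E]
    [FiniteDimensional ℝ E] (z : ι → E) (c w : ι → ℝ) (hw : ∀ i, 0 ≤ w i)
    (hcard : Module.finrank ℝ E + 1 < (Finset.univ.filter fun i ↦ w i ≠ 0).card) :
    ∃ v : ι → ℝ, (∀ i, 0 ≤ v i) ∧ ∑ i, v i = ∑ i, w i ∧ ∑ i, v i • z i = ∑ i, w i • z i ∧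
      ∑ i, v i * c i ≤ ∑ i, w i * c i ∧
      (Finset.univ.filter fun i ↦ v i ≠ 0).card < (Finset.univ.filter fun i ↦ w i ≠ 0).card := by
  classical
  set s := Finset.univ.filter fun i ↦ w i ≠ 0 with hs
  obtain ⟨d, hd0, hdz, hds, hdc, hdne⟩ : ∃ d : ι → ℝ, (∀ i ∉ s, d i = 0) ∧ ∑ i, d i • z i = 0 ∧
      ∑ i, d i = 0 ∧ ∑ i, d i * c i ≤ 0 ∧ ∃ i, d i ≠ 0 := by
    let ext : (s → ℝ) →ₗ[ℝ] (ι → ℝ) := Function.ExtendByZero.linearMap ℝ Subtype.val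
    let T : (s → ℝ) →ₗ[ℝ] E × ℝ :=
      (LinearMap.prod (Fintype.linearCombination ℝ z) (Fintype.linearCombination ℝ fun _ ↦ (1 : ℝ)))
        ∘ₗ ext
    have hT : LinearMap.ker T ≠ ⊥ := LinearMap.ker_ne_bot_of_finrank_lt (by simpa using hcard)
    obtain ⟨a, ha, ha0⟩ := (Submodule.ne_bot_iff _).1 hT
    have h1 : ∑ i, ext a i • z i = 0 ∧ ∑ i, ext a i = 0 := by
      simpa [T, Fintype.linearCombination_apply, Prod.ext_iff] using ha
    have h2 : ∀ i ∉ s, ext a i = 0 := fun i hi ↦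
      Function.extend_apply' _ _ _ (by rintro ⟨j, rfl⟩; exact hi j.2)
    have h3 : ∃ i, ext a i ≠ 0 := by
      obtain ⟨j, hj⟩ := Function.ne_iff.1 ha0
      refine ⟨j, ?_⟩
      have : ext a j = a j := Subtype.val_injective.extend_apply _ _ _
      rwa [this]
    rcases le_total (∑ i, ext a i * c i) 0 with h | h
    · exact ⟨ext a, h2, h1.1, h1.2, h, h3⟩
    · refine ⟨-ext a, fun i hi ↦ by simp [h2 i hi], ?_, ?_, ?_, ?_⟩
      · simp [h1.1]
      · simp [h1.2]
      · simpa using h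
      · simpa using h3
  obtain ⟨i₀, hi₀⟩ : ∃ i, d i < 0 := by
    by_contra! h
    obtain ⟨i, hi⟩ := hdne
    exact hi ((Finset.sum_eq_zero_iff_of_nonneg fun i _ ↦ h i).1 hds i (Finset.mem_univ i))
  obtain ⟨j, hj, hjmin⟩ := (Finset.univ.filter fun i ↦ d i < 0).exists_min_image
    (fun i ↦ w i / -d i) ⟨i₀, by simpa using hi₀⟩
  have hj : d j < 0 := by simpa using hj
  have hθ : 0 ≤ w j / -d j := div_nonneg (hw j) (by linarith)
  set θ := w j / -d j with hθdef
  have hjs : j ∈ s := by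
    by_contra h
    exact hj.ne (hd0 j h)
  refine ⟨fun i ↦ w i + θ * d i, fun i ↦ ?_, ?_, ?_, ?_, ?_⟩
  · rcases lt_or_ge (d i) 0 with h | h
    · have := hjmin i (by simpa using h)
      rw [le_div_iff₀ (by linarith)] at this
      linarith
    · have := hw i
      positivity
  · simp [Finset.sum_add_distrib, ← Finset.mul_sum, hds]
  · simp [Finset.sum_add_distrib, add_smul, mul_smul, ← Finset.smul_sum, hdz]
  · simp only [add_mul, Finset.sum_add_distrib, mul_assoc, ← Finset.mul_sum]
    nlinarith
  · refine Finset.card_lt_card (Finset.ssubset_iff_of_subset (fun i hi ↦ ?_) |>.2 ⟨j, hjs, ?_⟩)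
    · by_contra h
      have h' : w i = 0 := by simpa [hs] using h
      simp [h', hd0 i h] at hi
    · have : θ * d j = -w j := by rw [hθdef]; field_simp [hj.ne]
      simp [this]

/-- **Carathéodory's theorem** for points with a cost. -/
lemma exists_weights_card_support_le {ι E : Type*} [Fintype ι] [AddCommGroup E] [Module ℝ E]
    [FiniteDimensional ℝ E] (z : ι → E) (c w : ι → ℝ) (hw : ∀ i, 0 ≤ w i) :
    ∃ v : ι → ℝ, (∀ i, 0 ≤ v i) ∧ ∑ i, v i = ∑ i, w i ∧ ∑ i, v i • z i = ∑ i, w i • z i ∧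
      ∑ i, v i * c i ≤ ∑ i, w i * c i ∧
      (Finset.univ.filter fun i ↦ v i ≠ 0).card ≤ Module.finrank ℝ E + 1 := by
  induction h : (Finset.univ.filter fun i ↦ w i ≠ 0).card using Nat.strong_induction_on
    generalizing w with
  | _ m ih =>
    rcases le_or_gt m (Module.finrank ℝ E + 1) with hm | hm
    · exact ⟨w, hw, rfl, rfl, le_rfl, h ▸ hm⟩
    · obtain ⟨v, hv, h1, h2, h3, h4⟩ := exists_weights_card_support_lt z c w hw (h ▸ hm)
      obtain ⟨u, hu, k1, k2, k3, k4⟩ := ih _ (h ▸ h4) v hv rfl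
      exact ⟨u, hu, k1.trans h1, k2.trans h2, k3.trans h3, k4⟩

/-- Carathéodory's theorem for points with a cost, indexed by `Fin (finrank E + 1)`. -/
lemma exists_fin_weights {ι K E : Type*} [Fintype ι] [Nonempty K] [AddCommGroup E] [Module ℝ E]
    [FiniteDimensional ℝ E] {n : ℕ} (hn : Module.finrank ℝ E = n) (f : K → E) (g : K → ℝ)
    (z : ι → K) (w : ι → ℝ) (hw : ∀ i, 0 ≤ w i) (hw1 : ∑ i, w i = 1) :
    ∃ v ∈ stdSimplex ℝ (Fin (n + 1)), ∃ y : Fin (n + 1) → K,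
      ∑ k, v k • f (y k) = ∑ i, w i • f (z i) ∧ ∑ k, v k * g (y k) ≤ ∑ i, w i * g (z i) := by
  classical
  obtain ⟨v, hv, h1, h2, h3, h4⟩ :=
    exists_weights_card_support_le (fun i ↦ f (z i)) (fun i ↦ g (z i)) w hw
  rw [hn] at h4
  set s := Finset.univ.filter fun i ↦ v i ≠ 0 with hs
  obtain ⟨e⟩ : Nonempty (s ↪ Fin (n + 1)) := by
    apply Function.Embedding.nonempty_of_card_le
    simpa using h4
  let v' : Fin (n + 1) → ℝ := Function.extend e (fun i ↦ v i) 0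
  let y : Fin (n + 1) → K := Function.extend e (fun i ↦ z i) fun _ ↦ Classical.arbitrary K
  have key : ∑ k, v' k • (f (y k), g (y k), (1 : ℝ)) = ∑ i, v i • (f (z i), g (z i), (1 : ℝ)) := by
    rw [← Fintype.sum_of_injective e e.injective (fun i : s ↦ v i • (f (z i), g (z i), (1 : ℝ)))]
    · rw [Finset.sum_coe_sort s fun i ↦ v i • (f (z i), g (z i), (1 : ℝ))]
      refine Finset.sum_subset (Finset.subset_univ _) fun i _ hi ↦ ?_
      have : v i = 0 := by simpa [hs] using hi
      simp [this]
    · intro k hk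
      simp [v', Function.extend_apply' _ _ _ hk]
    · intro i
      simp [v', y, e.injective.extend_apply]
  simp only [Prod.smul_mk, Prod.ext_iff, Prod.fst_sum, Prod.snd_sum, smul_eq_mul, mul_one] at key
  refine ⟨v', ⟨fun k ↦ ?_, ?_⟩, y, ?_, ?_⟩
  · by_cases hk : ∃ i, e i = k
    · obtain ⟨i, rfl⟩ := hk
      simpa [v', e.injective.extend_apply] using hv i
    · simp [v', Function.extend_apply' _ _ _ hk]
  · rw [key.2.2, h1, hw1]
  · rw [key.1, h2]
  · rwa [key.2.1]

section Kext

variable {K E : Type*} [TopologicalSpace K] [CompactSpace K] [NormedAddCommGroup E]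
  [NormedSpace ℝ E] [FiniteDimensional ℝ E]

open scoped Pointwise in
/-- Among measures with prescribed barycenter, atomic measures with at most `finrank E + 1` atoms
attain integrals of a continuous function that are as small as possible. -/
lemma exists_fin_weights_integral [MeasurableSpace K] [BorelSpace K]
    (m : Measure K) [IsProbabilityMeasure m] {n : ℕ} (hn : Module.finrank ℝ E = n)
    {f : K → E} (hf : Continuous f) {g : K → ℝ} (hg : Continuous g) :
    ∃ v ∈ stdSimplex ℝ (Fin (n + 1)), ∃ y : Fin (n + 1) → K,
      ∑ k, v k • f (y k) = ∫ x, f x ∂m ∧ ∑ k, v k * g (y k) ≤ ∫ x, g x ∂m := by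
  have : Nonempty K := nonempty_of_isProbabilityMeasure m
  let A : Set (E × ℝ) := (fun p : (Fin (n + 1) → ℝ) × (Fin (n + 1) → K) ↦
    (∑ k, p.1 k • f (p.2 k), ∑ k, p.1 k * g (p.2 k))) '' (stdSimplex ℝ (Fin (n + 1)) ×ˢ Set.univ)
  let C : Set (E × ℝ) := {0} ×ˢ Set.Ici 0
  have hA : IsCompact A :=
    ((isCompact_stdSimplex ℝ _).prod isCompact_univ).image (by fun_prop)
  have hAC : IsClosed (A + C) :=
    (isClosed_singleton.prod isClosed_Ici).add_left_of_isCompact hA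
  have hmem : ∀ q : E × ℝ, q ∈ A + C ↔ ∃ v ∈ stdSimplex ℝ (Fin (n + 1)),
      ∃ y : Fin (n + 1) → K, ∑ k, v k • f (y k) = q.1 ∧ ∑ k, v k * g (y k) ≤ q.2 := by
    rintro ⟨q₁, q₂⟩
    constructor
    · rintro ⟨_, ⟨p, hp, rfl⟩, c, hc, h⟩
      simp only [Prod.ext_iff, Prod.fst_add, Prod.snd_add] at h
      obtain ⟨hc1, hc2⟩ : c.1 = 0 ∧ 0 ≤ c.2 := hc
      refine ⟨p.1, hp.1, p.2, ?_, ?_⟩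
      · simpa [hc1] using h.1
      · linarith [h.2]
    · rintro ⟨v, hv, y, h1, h2⟩
      refine ⟨_, ⟨(v, y), ⟨hv, Set.mem_univ _⟩, rfl⟩, (0, q₂ - ∑ k, v k * g (y k)), ⟨rfl, ?_⟩, ?_⟩
      · simpa using h2
      · simpa [Prod.ext_iff] using h1
  have hsub : convexHull ℝ (Set.range fun x ↦ (f x, g x)) ⊆ A + C := by
    intro q hq
    obtain ⟨ι, _, w, a, hw, hw1, ha, rfl⟩ := mem_convexHull_iff_exists_fintype.1 hq
    choose z hz using ha
    rw [hmem]
    obtain ⟨v, hv, y, h1, h2⟩ := exists_fin_weights hn f g z w hw hw1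
    exact ⟨v, hv, y, by simpa [← hz, Prod.fst_sum] using h1, by simpa [← hz, Prod.snd_sum] using h2⟩
  have hfi : Integrable f m := hf.integrable_of_hasCompactSupport (.of_compactSpace f)
  have hgi : Integrable g m := hg.integrable_of_hasCompactSupport (.of_compactSpace g)
  have hint : ∫ x, (f x, g x) ∂m ∈ closure (convexHull ℝ (Set.range fun x ↦ (f x, g x))) :=
    (convex_convexHull ℝ _).closure.integral_mem isClosed_closure
      (.of_forall fun x ↦ subset_closure (subset_convexHull ℝ _ ⟨x, rfl⟩)) (hfi.prodMk hgi)
  rw [integral_pair hfi hgi] at hint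
  exact (hmem _).1 (closure_minimal hsub hAC hint)

/-- A positive functional on a subspace of `C(S, ℝ)` containing the constants, given as the image
of a linear map, is represented by a measure. -/
lemma exists_measure_of_nonneg {V S : Type*} [AddCommGroup V] [Module ℝ V] [TopologicalSpace S]
    [CompactSpace S] [T2Space S] [MeasurableSpace S] [BorelSpace S] (T : V →ₗ[ℝ] C(S, ℝ))
    (L : V →ₗ[ℝ] ℝ) (hpos : ∀ v, (∀ s, 0 ≤ T v s) → 0 ≤ L v) (one : V) (hone : T one = 1) :
    ∃ ν : Measure S, IsFiniteMeasure ν ∧ ∀ v, ∫ s, T v s ∂ν = L v := by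
  have hker : LinearMap.ker T ≤ LinearMap.ker L := by
    intro v hv
    have hv : T v = 0 := hv
    have h1 := hpos v (by simp [hv])
    have h2 := hpos (-v) (by simp [hv])
    simp only [map_neg] at h2
    exact le_antisymm (by linarith) h1
  let L' : LinearMap.range T →ₗ[ℝ] ℝ :=
    (LinearMap.ker T).liftQ L hker ∘ₗ T.quotKerEquivRange.symm.toLinearMap
  have hL' : ∀ v, L' ⟨T v, v, rfl⟩ = L v := by
    intro v
    have : T.quotKerEquivRange.symm ⟨T v, v, rfl⟩ = (LinearMap.ker T).mkQ v :=
      T.quotKerEquivRange_symm_apply_image v _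
    simp [L', this]
  obtain ⟨Λ, hΛ, hΛpos⟩ := riesz_extension (PointedCone.positive ℝ C(S, ℝ)) ⟨LinearMap.range T, L'⟩
    (by
      rintro ⟨_, v, rfl⟩ hv
      exact (hpos v fun s ↦ ContinuousMap.le_def.1 hv s).trans_eq (hL' v).symm)
    (fun y ↦ by
      refine ⟨⟨T (‖y‖ • one), _, rfl⟩, ?_⟩
      simp only [PointedCone.mem_positive, map_smul, hone, ContinuousMap.le_def]
      intro s
      have := neg_le_of_abs_le (y.norm_coe_le_norm s)
      simp
      linarith)
  let Λ' : CompactlySupportedContinuousMap S ℝ →ₚ[ℝ] ℝ := PositiveLinearMap.mk₀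
    { toFun f := Λ f
      map_add' f g := Λ.map_add (f : C(S, ℝ)) g
      map_smul' c f := Λ.map_smul c (f : C(S, ℝ)) }
    (fun f hf ↦ hΛpos _ fun s ↦ hf s)
  refine ⟨RealRMK.rieszMeasure Λ', inferInstance, fun v ↦ ?_⟩
  have := RealRMK.integral_rieszMeasure Λ' (CompactlySupportedContinuousMap.continuousMapEquiv (T v))
  exact this.trans ((hΛ ⟨T v, v, rfl⟩).trans (hL' v))

/-- A probability measure on a compact space is a mixture of measures with at most `finrank E + 1`
atoms all of which give the same integral to `f`, when tested against continuous functions. -/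
lemma exists_mixture_continuous [T2Space K] [SecondCountableTopology K] [MeasurableSpace K]
    [BorelSpace K] (m : Measure K) [IsProbabilityMeasure m] {n : ℕ}
    (hn : Module.finrank ℝ E = n) {f : K → E} (hf : Continuous f) :
    ∃ ν : Measure (stdSimplex ℝ (Fin (n + 1)) × (Fin (n + 1) → K)), IsProbabilityMeasure ν ∧
      (∀ᵐ p ∂ν, ∑ k, p.1.1 k • f (p.2 k) = ∫ x, f x ∂m) ∧
      ∀ g : K → ℝ, Continuous g → ∫ p, ∑ k, p.1.1 k * g (p.2 k) ∂ν = ∫ x, g x ∂m := by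
  have hω (k) : Continuous fun p : stdSimplex ℝ (Fin (n + 1)) × (Fin (n + 1) → K) ↦ p.1.1 k :=
    (continuous_apply k).comp (continuous_subtype_val.comp continuous_fst)
  let S : Set (stdSimplex ℝ (Fin (n + 1)) × (Fin (n + 1) → K)) :=
    {p | ∑ k, p.1.1 k • f (p.2 k) = ∫ x, f x ∂m}
  have hS : IsClosed S := isClosed_eq
    (continuous_finsetSum _ fun k _ ↦ (hω k).smul (hf.comp (by fun_prop))) continuous_const
  have : CompactSpace S := isCompact_iff_compactSpace.1 hS.isCompact
  let T : C(K, ℝ) →ₗ[ℝ] C(S, ℝ) :=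
    { toFun g := ⟨fun s ↦ ∑ k, s.1.1.1 k * g (s.1.2 k), continuous_finsetSum _ fun k _ ↦
        ((hω k).comp continuous_subtype_val).mul (g.continuous.comp (by fun_prop))⟩
      map_add' g h := by ext s; simp [mul_add, Finset.sum_add_distrib]
      map_smul' c g := by ext s; simp [Finset.mul_sum, mul_left_comm] }
  have hint (g : C(K, ℝ)) : Integrable g m :=
    g.continuous.integrable_of_hasCompactSupport (.of_compactSpace g)
  let L : C(K, ℝ) →ₗ[ℝ] ℝ :=
    { toFun g := ∫ x, g x ∂m
      map_add' g h := integral_add (hint g) (hint h)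
      map_smul' c g := integral_const_mul c g }
  have hone : T 1 = 1 := by
    ext s
    simpa [T] using s.1.1.2.2
  obtain ⟨ν, hν, hνT⟩ := exists_measure_of_nonneg T L (fun g hg ↦ by
    obtain ⟨v, hv, y, h1, h2⟩ := exists_fin_weights_integral m hn hf g.continuous
    exact (hg ⟨(⟨v, hv⟩, y), h1⟩).trans h2) 1 hone
  have hprob : IsProbabilityMeasure ν := by
    have h := hνT 1
    rw [hone] at h
    have h' : ν.real Set.univ = 1 := by simpa [L] using h
    exact ⟨by simpa [Measure.real, ENNReal.toReal_eq_one_iff] using h'⟩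
  refine ⟨ν.map Subtype.val, Measure.isProbabilityMeasure_map (by fun_prop), ?_, fun g hg ↦ ?_⟩
  · rw [ae_map_iff (by fun_prop) hS.measurableSet]
    exact .of_forall fun s ↦ s.2
  · rw [(MeasurableEmbedding.subtype_coe hS.measurableSet).integral_map]
    exact hνT ⟨g, hg⟩

/-- A probability measure on a compact space is a mixture of measures with at most `finrank E + 1`
atoms all of which give the same integral to `f`. -/
lemma exists_mixture [TopologicalSpace.MetrizableSpace K] [SecondCountableTopology K]
    [MeasurableSpace K] [BorelSpace K] (m : Measure K) [IsProbabilityMeasure m] {n : ℕ}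
    (hn : Module.finrank ℝ E = n) {f : K → E} (hf : Continuous f) :
    ∃ ν : Measure (stdSimplex ℝ (Fin (n + 1)) × (Fin (n + 1) → K)), IsProbabilityMeasure ν ∧
      (∀ᵐ p ∂ν, ∑ k, p.1.1 k • f (p.2 k) = ∫ x, f x ∂m) ∧
      ∀ g : K → ℝ, Measurable g → (∃ C : ℝ, ∀ x, |g x| ≤ C) →
        (∀ k, Integrable (fun p ↦ p.1.1 k * g (p.2 k)) ν) ∧
        ∫ p, ∑ k, p.1.1 k * g (p.2 k) ∂ν = ∫ x, g x ∂m := by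
  obtain ⟨ν, hν, hνf, hνg⟩ := exists_mixture_continuous m hn hf
  refine ⟨ν, hν, hνf, ?_⟩
  have hω (k) : Measurable fun p : stdSimplex ℝ (Fin (n + 1)) × (Fin (n + 1) → K) ↦ p.1.1 k :=
    (measurable_pi_apply k).comp (measurable_subtype_coe.comp measurable_fst)
  have hω0 (p : stdSimplex ℝ (Fin (n + 1)) × (Fin (n + 1) → K)) (k) : 0 ≤ p.1.1 k := p.1.2.1 k
  have hω1 (p : stdSimplex ℝ (Fin (n + 1)) × (Fin (n + 1) → K)) (k) : p.1.1 k ≤ 1 :=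
    (Finset.single_le_sum (fun i _ ↦ hω0 p i) (Finset.mem_univ k)).trans_eq p.1.2.2
  let d (k : Fin (n + 1)) : Measure K :=
    (ν.withDensity fun p ↦ ENNReal.ofReal (p.1.1 k)).map fun p ↦ p.2 k
  have hfin (k) : IsFiniteMeasure (ν.withDensity fun p ↦ ENNReal.ofReal (p.1.1 k)) := by
    refine isFiniteMeasure_withDensity (ne_top_of_le_ne_top (b := 1) (by simp) ?_)
    calc ∫⁻ p, ENNReal.ofReal (p.1.1 k) ∂ν ≤ ∫⁻ p, 1 ∂ν :=
          lintegral_mono fun p ↦ by simpa using hω1 p k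
      _ = 1 := by simp
  have hdfin (k) : IsFiniteMeasure (d k) := by dsimp [d]; infer_instance
  have hd (g : K → ℝ) (hg : Measurable g) (hb : ∃ C : ℝ, ∀ x, |g x| ≤ C) :
      (∀ k, Integrable (fun p ↦ p.1.1 k * g (p.2 k)) ν) ∧
      ∫ p, ∑ k, p.1.1 k * g (p.2 k) ∂ν = ∫ x, g x ∂(∑ k, d k) := by
    obtain ⟨C, hC⟩ := hb
    have hi (k) : Integrable (fun p ↦ p.1.1 k * g (p.2 k)) ν := by
      refine Integrable.of_bound (C := C) (Measurable.aestronglyMeasurable ?_) (.of_forall fun p ↦ ?_)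
      · exact (hω k).mul (hg.comp (by fun_prop))
      · rw [Real.norm_eq_abs, abs_mul, abs_of_nonneg (hω0 p k)]
        have := hω1 p k
        nlinarith [hC (p.2 k), abs_nonneg (g (p.2 k)), hω0 p k]
    refine ⟨hi, ?_⟩
    rw [integral_finsetSum _ fun k _ ↦ hi k, integral_finsetSum_measure]
    · refine Finset.sum_congr rfl fun k _ ↦ ?_
      rw [integral_map (by fun_prop) hg.aestronglyMeasurable,
        integral_withDensity_eq_integral_toReal_smul (hω k).ennreal_ofReal (by simp)]
      simp [ENNReal.toReal_ofReal (hω0 _ k)]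
    · exact fun k _ ↦ Integrable.of_bound hg.aestronglyMeasurable C (.of_forall hC)
  have hm : ∑ k, d k = m := by
    refine ext_of_forall_integral_eq_of_IsFiniteMeasure fun g ↦ ?_
    rw [← (hd g g.continuous.measurable ⟨‖g‖, g.norm_coe_le_norm⟩).2]
    exact hνg g g.continuous
  rwa [hm] at hd

end Kext

/-- The probability measure with atoms `p.2 k` of mass `p.1 k`. -/
noncomputable def atomicMeasure {ι X : Type*} [Fintype ι] [MeasurableSpace X]
    (p : stdSimplex ℝ ι × (ι → X)) : ProbabilityMeasure X :=
  ⟨∑ k, ENNReal.ofReal (p.1.1 k) • Measure.dirac (p.2 k), ⟨by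
    have h := p.1.2.2
    simp [← ENNReal.ofReal_sum_of_nonneg fun k _ ↦ p.1.2.1 k, h]⟩⟩

lemma integral_atomicMeasure {ι X : Type*} [Fintype ι] [MeasurableSpace X]
    [MeasurableSingletonClass X] (p : stdSimplex ℝ ι × (ι → X)) (g : X → ℝ) :
    ∫ x, g x ∂(atomicMeasure p : Measure X) = ∑ k, p.1.1 k * g (p.2 k) := by
  change ∫ x, g x ∂(∑ k, ENNReal.ofReal (p.1.1 k) • Measure.dirac (p.2 k)) = _
  rw [integral_finsetSum_measure fun k _ ↦
    (integrable_dirac (by simp [enorm_lt_top])).smul_measure ENNReal.ofReal_ne_top]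
  refine Finset.sum_congr rfl fun k _ ↦ ?_
  rw [integral_smul_measure, integral_dirac, ENNReal.toReal_ofReal (p.1.2.1 k), smul_eq_mul]

lemma continuous_atomicMeasure {ι X : Type*} [Fintype ι] [TopologicalSpace X] [T1Space X]
    [MeasurableSpace X] [BorelSpace X] :
    Continuous (atomicMeasure : stdSimplex ℝ ι × (ι → X) → ProbabilityMeasure X) := by
  refine ProbabilityMeasure.continuous_iff_forall_continuous_integral.2 fun g ↦ ?_
  simp only [integral_atomicMeasure]
  exact continuous_finsetSum _ fun k _ ↦
    ((continuous_apply k).comp (continuous_subtype_val.comp continuous_fst)).mul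
      (g.continuous.comp (by fun_prop))

/-- A standard Borel space with finitely many bounded measurable functions embeds measurably in a
compact space in such a way that these functions extend continuously. -/
lemma exists_measurableEmbedding_compact {X : Type*} [MeasurableSpace X] [StandardBorelSpace X]
    {n : ℕ} (φ : Fin n → X → ℝ) (hφm : ∀ j, Measurable (φ j))
    (hφb : ∀ j, ∃ C : ℝ, ∀ x, |φ j x| ≤ C) :
    ∃ C : Fin n → ℝ, ∃ e : X → (∀ j, Set.Icc (-C j) (C j)) × (ℕ → Bool),
      MeasurableEmbedding e ∧ ∀ x j, ((e x).1 j : ℝ) = φ j x := by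
  choose C hC using hφb
  obtain ⟨i, him, hi⟩ := MeasurableSpace.measurable_injection_nat_bool_of_countablySeparated X
  refine ⟨C, fun x ↦ (fun j ↦ ⟨φ j x, abs_le.1 (hC j x)⟩, i x), ?_, fun _ _ ↦ rfl⟩
  refine Measurable.measurableEmbedding (Measurable.prodMk ?_ him) fun x y h ↦ hi (Prod.ext_iff.1 h).2
  exact measurable_pi_lambda _ fun j ↦ (hφm j).subtype_mk

theorem stmt_0
    {X : Type*} [TopologicalSpace X] [PolishSpace X] [MeasurableSpace X] [BorelSpace X]
    [MeasurableSpace (ProbabilityMeasure X)] [BorelSpace (ProbabilityMeasure X)]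
    (n : ℕ) (φ : Fin n → X → ℝ)
    (hφm : ∀ j, Measurable (φ j)) (hφb : ∀ j, ∃ C : ℝ, ∀ x, |φ j x| ≤ C)
    (Astar : Set (ProbabilityMeasure X))
    (hAstar : Astar = {μ : ProbabilityMeasure X | ∀ j, ∫ x, φ j x ∂(μ : Measure X) ≤ 0})
    (Δ : Set (ProbabilityMeasure X))
    (hΔ : Δ = {μ : ProbabilityMeasure X | μ ∈ Astar ∧
      ∃ (ω : Fin (n + 1) → ℝ≥0∞) (x : Fin (n + 1) → X),
        ∑ k, ω k = 1 ∧ (μ : Measure X) = ∑ k, ω k • Measure.dirac (x k)})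
    (μ : ProbabilityMeasure X) (hμ : μ ∈ Astar) :
    ∃ ν : Measure (ProbabilityMeasure X), IsProbabilityMeasure ν ∧ ν Δ = 1 ∧
      ∀ g : X → ℝ, Continuous g → (∃ C : ℝ, ∀ x, |g x| ≤ C) →
        ∫ x, g x ∂(μ : Measure X) = ∫ s, (∫ x, g x ∂(s : Measure X)) ∂ν := by
  have : Nonempty X := nonempty_of_isProbabilityMeasure (μ : Measure X)
  obtain ⟨C, e, he, hφe⟩ := exists_measurableEmbedding_compact φ hφm hφb
  obtain ⟨r, hr, hre⟩ := he.exists_measurable_extend measurable_id fun _ ↦ this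
  replace hre : ∀ x, r (e x) = x := congrFun hre
  set m := (μ : Measure X).map e
  have : IsProbabilityMeasure m := Measure.isProbabilityMeasure_map he.measurable.aemeasurable
  let f : (∀ j, Set.Icc (-C j) (C j)) × (ℕ → Bool) → Fin n → ℝ := fun y j ↦ y.1 j
  have hf : Continuous f := by fun_prop
  obtain ⟨ν, hν, hνf, hνg⟩ := exists_mixture m (n := n) (by simp) hf
  have hfm : ∀ j, (∫ y, f y ∂m) j ≤ 0 := by
    intro j
    rw [hAstar] at hμ
    rw [eval_integral fun j ↦ Continuous.integrable_of_hasCompactSupport (by fun_prop)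
      (.of_compactSpace _), he.integral_map]
    simpa [f, hφe] using hμ j
  let ρ : stdSimplex ℝ (Fin (n + 1)) ×
      (Fin (n + 1) → (∀ j, Set.Icc (-C j) (C j)) × (ℕ → Bool)) → ProbabilityMeasure X :=
    fun p ↦ atomicMeasure (p.1, fun k ↦ r (p.2 k))
  have hρ : Measurable ρ := continuous_atomicMeasure.measurable.comp
    (measurable_fst.prodMk (measurable_pi_lambda _ fun k ↦ hr.comp (by fun_prop)))
  have hsupp : ∀ᵐ p ∂ν, ∀ k, p.2 k ∈ Set.range e ∨ p.1.1 k = 0 := by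
    let g : (∀ j, Set.Icc (-C j) (C j)) × (ℕ → Bool) → ℝ := (Set.range e)ᶜ.indicator 1
    have hg0 : 0 ≤ g := Set.indicator_nonneg fun _ _ ↦ zero_le_one
    obtain ⟨hgi, hg⟩ := hνg g (measurable_one.indicator he.measurableSet_range.compl)
      ⟨1, fun y ↦ by
        rw [abs_of_nonneg (hg0 y)]
        exact Set.indicator_le_self' (fun _ _ ↦ zero_le_one) y⟩
    rw [he.integral_map] at hg
    have hzero : ∀ x, g (e x) = 0 := fun x ↦ by simp [g]
    simp only [hzero, integral_zero] at hg
    have hnn (p : stdSimplex ℝ (Fin (n + 1)) ×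
        (Fin (n + 1) → (∀ j, Set.Icc (-C j) (C j)) × (ℕ → Bool))) (k) : 0 ≤ p.1.1 k * g (p.2 k) :=
      mul_nonneg (p.1.2.1 k) (hg0 _)
    rw [integral_eq_zero_iff_of_nonneg (fun p ↦ Finset.sum_nonneg fun k _ ↦ hnn p k)
      (integrable_finsetSum _ fun k _ ↦ hgi k)] at hg
    filter_upwards [hg] with p hp k
    have := (Finset.sum_eq_zero_iff_of_nonneg fun k _ ↦ hnn p k).1 hp k (Finset.mem_univ k)
    by_contra! h
    simp [g, h.1, h.2] at this
  refine ⟨ν.map ρ, Measure.isProbabilityMeasure_map hρ.aemeasurable, ?_, fun g hg hgb ↦ ?_⟩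
  · have : IsProbabilityMeasure (ν.map ρ) := Measure.isProbabilityMeasure_map hρ.aemeasurable
    refine le_antisymm prob_le_one ?_
    refine le_trans ?_ (Measure.le_map_apply hρ.aemeasurable Δ)
    have hae : ∀ᵐ p ∂ν, p ∈ ρ ⁻¹' Δ := by
      filter_upwards [hνf, hsupp] with p hpf hps
      rw [hΔ, hAstar]
      refine ⟨fun j ↦ ?_, fun k ↦ ENNReal.ofReal (p.1.1 k), fun k ↦ r (p.2 k), ?_, rfl⟩
      · rw [integral_atomicMeasure]
        refine le_trans (le_of_eq ?_) (hfm j)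
        rw [← hpf, Finset.sum_apply]
        refine Finset.sum_congr rfl fun k _ ↦ ?_
        rcases hps k with ⟨x, hx⟩ | h
        · simp [← hx, hre, f, hφe]
        · simp [h]
      · rw [← ENNReal.ofReal_sum_of_nonneg fun k _ ↦ p.1.2.1 k, p.1.2.2, ENNReal.ofReal_one]
    exact (measure_univ.symm.trans (measure_congr (Filter.eventuallyEq_univ.2 hae)).symm).le
  · obtain ⟨B, hB⟩ := hgb
    have hcont : Continuous fun s : ProbabilityMeasure X ↦ ∫ x, g x ∂(s : Measure X) :=
      ProbabilityMeasure.continuous_integral_boundedContinuousFunction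
        (BoundedContinuousFunction.ofNormedAddCommGroup g hg B hB)
    rw [integral_map hρ.aemeasurable hcont.aestronglyMeasurable]
    simp only [ρ, integral_atomicMeasure]
    rw [(hνg (fun y ↦ g (r y)) (hg.measurable.comp hr) ⟨B, fun y ↦ hB _⟩).2, he.integral_map]
    simp [hre]
end

section
/- Let X₁,…,X_d be Polish spaces, fix an index i, and fix Borel probability measures μ_j ∈ P(X_j) for j ≠ i. Let φ_i^{(1)},…,φ_i^{(N_i)} : X_i → ℝ be bounded measurable and set A_i = {μ ∈ P(X_i) : ∫ φ_i^{(j)} dμ ≤ 0, 1 ≤ j ≤ N_i}; let Δ_i(N_i+1) be the set of measures in A_i that are convex combinations of at most N_i + 2 Dirac masses. Let G : X₁ × ⋯ × X_d → ℝ be bounded measurable, and for μ_i ∈ P(X_i) write μ = μ₁ ⊗ ⋯ ⊗ μ_d, g(x_i) = ∫ G d(⊗_{j≠i} μ_j) (the conditional mean of Y = G given X_i = x_i), and define the first-order Sobol' index S_i(μ_i) = (∫ g² dμ_i − (∫ G dμ)²) / (∫ G² dμ − (∫ G dμ)²). Assume the output variance ∫ G² dμ − (∫ G dμ)² is strictly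 positive for every μ_i ∈ A_i. Then sup_{μ_i ∈ A_i} S_i(μ_i) = sup_{μ_i ∈ Δ_i(N_i+1)} S_i(μ_i) and inf_{μ_i ∈ A_i} S_i(μ_i) = inf_{μ_i ∈ Δ_i(N_i+1)} S_i(μ_i). -/
open MeasureTheory
open scoped ENNReal

/-- In finite dimension, the barycenter of a probability measure carried by a set `s` lies in the
convex hull of `s`, with no closedness assumption. -/
theorem integral_mem_convexHull_of_finiteDimensional {Ω E : Type*} [MeasurableSpace Ω]
    (μ : Measure Ω) [IsProbabilityMeasure μ] [NormedAddCommGroup E] [NormedSpace ℝ E]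
    [FiniteDimensional ℝ E] {s : Set E} {p : Ω → E} (hp : Integrable p μ)
    (hs : ∀ᵐ x ∂μ, p x ∈ s) : ∫ x, p x ∂μ ∈ convexHull ℝ s := by
  induction hn : Module.finrank ℝ E using Nat.strong_induction_on generalizing E with
  | _ n ih =>
  subst hn
  have : CompleteSpace E := FiniteDimensional.complete ℝ E
  by_contra hb
  set b := ∫ x, p x ∂μ with hb_def
  have hcomp (f : StrongDual ℝ E) : ∫ x, f (p x) ∂μ = f b := f.integral_comp_comm hp
  obtain ⟨f, hf0, hf⟩ : ∃ f : StrongDual ℝ E, f ≠ 0 ∧ ∀ a ∈ convexHull ℝ s, f a ≤ f b := by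
    by_cases hint : (interior (convexHull ℝ s)).Nonempty
    · exact geometric_hahn_banach_of_nonempty_interior_point (convex_convexHull ℝ s)
        (fun h => hb (interior_subset h)) hint
    · rw [interior_convexHull_nonempty_iff_affineSpan_eq_top] at hint
      obtain ⟨x₀, hx₀⟩ := hs.exists
      have hmem : p x₀ ∈ affineSpan ℝ s := subset_affineSpan ℝ s hx₀
      have hdir : (affineSpan ℝ s).direction < ⊤ := by
        rw [lt_top_iff_ne_top, ne_eq, AffineSubspace.direction_eq_top_iff_of_nonempty ⟨_, hmem⟩]
        exact hint
      obtain ⟨f, hf0, hf⟩ := Submodule.exists_le_ker_of_lt_top _ hdir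
      have hconst : ∀ a ∈ affineSpan ℝ s, f a = f (p x₀) := fun a ha => by
        have := hf (AffineSubspace.vsub_mem_direction ha hmem)
        simpa [sub_eq_zero] using this
      have hb' : f b = f (p x₀) := by
        have h := hcomp f.toContinuousLinearMap
        rw [integral_congr_ae (g := fun _ => f (p x₀)) (by
          exact hs.mono fun x hx => hconst _ (subset_affineSpan ℝ s hx))] at h
        simpa using h.symm
      refine ⟨f.toContinuousLinearMap, by simpa using hf0, fun a ha => ?_⟩
      simpa [hb'] using (hconst a (convexHull_subset_affineSpan s ha)).le
  have hker : ∀ᵐ x ∂μ, f (p x - b) = 0 := by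
    have hint : Integrable (fun x => f b - f (p x)) μ :=
      (integrable_const _).sub (f.integrable_comp hp)
    have h0 : ∫ x, (f b - f (p x)) ∂μ = 0 := by
      rw [integral_sub (integrable_const _) (f.integrable_comp hp), hcomp]
      simp
    rw [integral_eq_zero_iff_of_nonneg_ae
      (hs.mono fun x hx => sub_nonneg.2 (hf _ (subset_convexHull ℝ s hx))) hint] at h0
    filter_upwards [h0] with x hx
    simp only [Pi.zero_apply] at hx
    rw [map_sub]; linarith
  let K := LinearMap.ker (f : E →ₗ[ℝ] ℝ)
  obtain ⟨q, hq⟩ := K.subtype.exists_leftInverse_of_injective K.ker_subtype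
  have hqK (v : E) (hv : f v = 0) : (q v : E) = v := by
    have := LinearMap.congr_fun hq ⟨v, hv⟩
    simpa using congrArg Subtype.val this
  have hlt : Module.finrank ℝ K < Module.finrank ℝ E := by
    refine Submodule.finrank_lt fun h => hf0 ?_
    ext v
    exact (LinearMap.congr_fun (LinearMap.ker_eq_top.1 h) v)
  have hpb : Integrable (fun x => p x - b) μ := hp.sub (integrable_const _)
  have key := ih _ hlt (E := K) (s := {v | (v : E) + b ∈ s})
    (p := fun x => q.toContinuousLinearMap (p x - b))
    (q.toContinuousLinearMap.integrable_comp hpb) (by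
      filter_upwards [hs, hker] with x hx hx'
      have := hqK _ hx'
      simpa only [Set.mem_ofPred_eq, LinearMap.coe_toContinuousLinearMap', this, sub_add_cancel]
        using hx) rfl
  rw [ContinuousLinearMap.integral_comp_comm _ hpb, integral_sub hp (integrable_const _)] at key
  simp only [integral_const, probReal_univ, one_smul, ← hb_def, sub_self, map_zero] at key
  refine hb ?_
  let T : K →ᵃ[ℝ] E := K.subtype.toAffineMap + AffineMap.const ℝ K b
  have hT : T 0 ∈ T '' convexHull ℝ {v : K | (v : E) + b ∈ s} := Set.mem_image_of_mem T key
  rw [T.image_convexHull] at hT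
  have h0 : T 0 = b := by simp [T]
  rw [h0] at hT
  refine convexHull_mono ?_ hT
  rintro _ ⟨v, hv, rfl⟩
  simpa [T] using hv

/-- A finite convex combination can be replaced by one with at most `finrank E + 1` points that
preserves the mean of `P` and does not decrease the mean of `f`. -/
theorem exists_convex_combination_card_le {E : Type*} [AddCommGroup E] [Module ℝ E]
    [FiniteDimensional ℝ E] {ι : Type*} (P : ι → E) (f : ι → ℝ) (t : Finset ι) (w : ι → ℝ)
    (hw : ∀ k ∈ t, 0 ≤ w k) (hw1 : ∑ k ∈ t, w k = 1) :
    ∃ (t' : Finset ι) (w' : ι → ℝ), t'.card ≤ Module.finrank ℝ E + 1 ∧ (∀ k ∈ t', 0 ≤ w' k) ∧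
      ∑ k ∈ t', w' k = 1 ∧ ∑ k ∈ t', w' k • P k = ∑ k ∈ t, w k • P k ∧
      ∑ k ∈ t, w k * f k ≤ ∑ k ∈ t', w' k * f k := by
  classical
  induction hn : t.card using Nat.strong_induction_on generalizing t w with
  | _ n ih =>
  subst hn
  by_cases hcard : t.card ≤ Module.finrank ℝ E + 1
  · exact ⟨t, w, hcard, hw, hw1, rfl, le_rfl⟩
  have hdep : ¬ LinearIndepOn ℝ (fun k => (P k, (1 : ℝ))) (t : Set ι) := fun h => by
    have := LinearIndependent.fintype_card_le_finrank h
    simp at this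
    omega
  rw [linearIndepOn_finset_iff] at hdep
  push Not at hdep
  obtain ⟨c, hc, k₀, hk₀, hck₀⟩ := hdep
  simp only [Prod.smul_mk, smul_eq_mul, mul_one, Prod.ext_iff, Prod.fst_sum, Prod.snd_sum,
    Prod.fst_zero, Prod.snd_zero] at hc
  obtain ⟨c, hcP, hc1, hcf, hck₀⟩ : ∃ c : ι → ℝ, ∑ k ∈ t, c k • P k = 0 ∧ ∑ k ∈ t, c k = 0 ∧
      0 ≤ ∑ k ∈ t, c k * f k ∧ c k₀ ≠ 0 := by
    rcases le_total 0 (∑ k ∈ t, c k * f k) with h | h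
    · exact ⟨c, hc.1, hc.2, h, hck₀⟩
    · exact ⟨-c, by simp [hc.1], by simp [hc.2], by simpa using h, by simpa using hck₀⟩
  obtain ⟨k₁, hk₁, hck₁⟩ : ∃ k ∈ t, c k < 0 := by
    by_contra! h
    exact hck₀ ((Finset.sum_eq_zero_iff_of_nonneg h).1 hc1 k₀ hk₀)
  obtain ⟨m, hm, hmin⟩ := (t.filter fun k => c k < 0).exists_min_image (fun k => w k / (-c k))
    ⟨k₁, by simp [hk₁, hck₁]⟩
  simp only [Finset.mem_filter] at hm hmin
  set r := w m / (-c m) with hr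
  have hr0 : 0 ≤ r := div_nonneg (hw m hm.1) (by linarith)
  have hrm : w m + r * c m = 0 := by
    have := hm.2.ne
    rw [hr]; field_simp; ring
  have hw' : ∀ k ∈ t, 0 ≤ w k + r * c k := fun k hk => by
    rcases lt_or_ge (c k) 0 with h | h
    · have := hmin k ⟨hk, h⟩
      rw [le_div_iff₀ (by linarith)] at this
      linarith
    · have := hw k hk
      positivity
  obtain ⟨t', w', h1, h2, h3, h4, h5⟩ := ih (t.erase m).card (Finset.card_erase_lt_of_mem hm.1)
    (t.erase m) (fun k => w k + r * c k) (fun k hk => hw' k (Finset.mem_of_mem_erase hk))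
    (by
      rw [Finset.sum_erase t (f := fun k => w k + r * c k) hrm,
        Finset.sum_add_distrib, ← Finset.mul_sum, hc1, hw1]
      simp) rfl
  refine ⟨t', w', h1, h2, h3, ?_, le_trans ?_ h5⟩
  · rw [h4, Finset.sum_erase _ (by simp [hrm])]
    simp_rw [add_smul, mul_smul]
    rw [Finset.sum_add_distrib, ← Finset.smul_sum, hcP]; simp
  · rw [Finset.sum_erase _ (by simp [hrm])]
    simp_rw [add_mul, mul_assoc]
    rw [Finset.sum_add_distrib, ← Finset.mul_sum]
    nlinarith

theorem integral_sum_smul_dirac {X ι : Type*} [MeasurableSpace X] [MeasurableSingletonClass X]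
    [Fintype ι] {w : ι → ℝ} (hw : ∀ k, 0 ≤ w k) (x : ι → X) (h : X → ℝ) :
    ∫ y, h y ∂(∑ k, ENNReal.ofReal (w k) • Measure.dirac (x k)) = ∑ k, w k * h (x k) := by
  rw [integral_finsetSum_measure fun k _ =>
    (integrable_dirac (by simp)).smul_measure ENNReal.ofReal_ne_top]
  simp [integral_smul_measure, ENNReal.toReal_ofReal (hw _)]

/-- A probability measure can be replaced by a convex combination of `N + 1` Dirac masses with the
same `N` generalized moments and a larger integral of a further function. -/
theorem exists_sum_dirac_integral_eq_and_le {X : Type*} [MeasurableSpace X]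
    [MeasurableSingletonClass X] (μ : Measure X) [IsProbabilityMeasure μ] {N : ℕ}
    {ψ : Fin N → X → ℝ} (hψ : ∀ j, Integrable (ψ j) μ) {f : X → ℝ} (hf : Integrable f μ) :
    ∃ (ω : Fin (N + 1) → ℝ≥0∞) (x : Fin (N + 1) → X), ∑ k, ω k = 1 ∧
      (∀ j, ∫ y, ψ j y ∂(∑ k, ω k • Measure.dirac (x k)) = ∫ y, ψ j y ∂μ) ∧
      ∫ y, f y ∂μ ≤ ∫ y, f y ∂(∑ k, ω k • Measure.dirac (x k)) := by
  classical
  have hψ' : Integrable (fun x j => ψ j x) μ := Integrable.of_eval hψ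
  have hmem := integral_mem_convexHull_of_finiteDimensional μ
    (hψ'.prodMk hf) (Filter.Eventually.of_forall fun x => Set.mem_range_self x)
  rw [mem_convexHull_iff_exists_fintype] at hmem
  obtain ⟨ι, _, w, z, hw, hw1, hz, hsum⟩ := hmem
  choose x hx using hz
  obtain ⟨t, v, hcard, hv, hv1, hvP, hvf⟩ := exists_convex_combination_card_le
    (fun k j => ψ j (x k)) (fun k => f (x k)) Finset.univ w (fun k _ => hw k) hw1
  rw [Module.finrank_fin_fun] at hcard
  obtain ⟨e⟩ : Nonempty (t ↪ Fin (N + 1)) :=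
    Function.Embedding.nonempty_of_card_le (by simpa using hcard)
  obtain ⟨k₀, -⟩ : t.Nonempty := Finset.nonempty_of_sum_ne_zero (by rw [hv1]; exact one_ne_zero)
  let W : Fin (N + 1) → ℝ := Function.extend e (fun k => v k) 0
  let Y : Fin (N + 1) → X := Function.extend e (fun k => x k) fun _ => x k₀
  have hW (k : t) : W (e k) = v k := e.injective.extend_apply _ _ _
  have hY (k : t) : Y (e k) = x k := e.injective.extend_apply _ _ _
  have hW' (k) (hk : k ∉ Set.range e) : W k = 0 := Function.extend_apply' _ _ _ hk
  have hW0 (k) : 0 ≤ W k := by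
    by_cases hk : k ∈ Set.range e
    · obtain ⟨a, rfl⟩ := hk
      rw [hW]; exact hv _ a.2
    · rw [hW' k hk]
  have hWsum (h : X → ℝ) : ∑ k, W k * h (Y k) = ∑ k ∈ t, v k * h (x k) := by
    rw [← Finset.sum_coe_sort t]
    exact (Fintype.sum_of_injective e e.injective (fun k : t => v k * h (x k))
      (fun k => W k * h (Y k)) (fun k hk => by simp [hW' k hk])
      fun k => by rw [hW, hY]).symm
  have hfst := congrArg Prod.fst hsum
  have hsnd := congrArg Prod.snd hsum
  rw [fst_integral (hψ'.prodMk hf)] at hfst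
  rw [snd_integral (hψ'.prodMk hf)] at hsnd
  simp only [← hx, Prod.fst_sum, Prod.snd_sum, Prod.smul_mk, smul_eq_mul] at hfst hsnd
  refine ⟨fun k => ENNReal.ofReal (W k), Y, ?_, fun j => ?_, ?_⟩
  · rw [← ENNReal.ofReal_sum_of_nonneg fun k _ => hW0 k]
    have := hWsum fun _ => 1
    simp only [mul_one] at this
    rw [this, hv1, ENNReal.ofReal_one]
  · rw [integral_sum_smul_dirac hW0, hWsum]
    have h := congrFun (hvP.trans hfst) j
    rw [eval_integral hψ] at h
    simpa using h
  · rw [integral_sum_smul_dirac hW0, hWsum, ← hsnd]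
    exact hvf

/-- Replacing one factor of a product measure: integrate the other coordinates first. -/
theorem integral_pi_update {ι : Type*} [Fintype ι] [DecidableEq ι] {X : ι → Type*}
    [∀ j, MeasurableSpace (X j)] (ρ : ∀ j, ProbabilityMeasure (X j)) (i : ι)
    (μ : ProbabilityMeasure (X i)) {G : (∀ j, X j) → ℝ} (hG : Measurable G)
    {C : ℝ} (hC : ∀ x, |G x| ≤ C) :
    ∫ y, G y ∂(Measure.pi fun j => (Function.update ρ i μ j : Measure (X j))) =
      ∫ x, ∫ y, G (Function.update y i x) ∂(Measure.pi fun j => (ρ j : Measure (X j)))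
        ∂(μ : Measure (X i)) := by
  have hmap : (Measure.pi fun j => (Function.update ρ i μ j : Measure (X j))) =
      ((Measure.pi fun j => (ρ j : Measure (X j))).prod (μ : Measure (X i))).map
        (fun q => Function.update q.1 i q.2) := by
    refine Measure.pi_eq fun s hs => ?_
    rw [Measure.map_apply measurable_update' (MeasurableSet.univ_pi hs)]
    have hpre : (fun q : (∀ j, X j) × X i => Function.update q.1 i q.2) ⁻¹' Set.univ.pi s =
        (Set.univ.pi (Function.update s i Set.univ)) ×ˢ s i := by
      ext q
      simp only [Set.mem_preimage, Set.mem_univ_pi, Set.mem_prod]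
      refine ⟨fun h => ⟨fun j => ?_, by simpa using h i⟩, fun h j => ?_⟩
      · by_cases hj : j = i
        · subst hj; simp
        · simpa [hj] using h j
      · by_cases hj : j = i
        · subst hj; simpa using h.2
        · simpa [hj] using h.1 j
    rw [hpre, Measure.prod_prod, Measure.pi_pi, ← Finset.mul_prod_erase _ _ (Finset.mem_univ i),
      ← Finset.mul_prod_erase Finset.univ _ (Finset.mem_univ i)]
    simp only [Function.update_self, measure_univ, one_mul]
    rw [mul_comm]
    congr 1
    refine Finset.prod_congr rfl fun j hj => ?_
    simp [Finset.ne_of_mem_erase hj]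
  have hGm := hG.comp (measurable_update' (X := X) (a := i))
  rw [hmap, integral_map measurable_update'.aemeasurable hG.aestronglyMeasurable,
    integral_prod_symm]
  exact .of_bound hGm.aestronglyMeasurable C (.of_forall fun q => hC _)

theorem measurable_integral_update {ι : Type*} [Fintype ι] [DecidableEq ι] {X : ι → Type*}
    [∀ j, MeasurableSpace (X j)] (ρ : ∀ j, ProbabilityMeasure (X j)) (i : ι)
    {G : (∀ j, X j) → ℝ} (hG : Measurable G) :
    Measurable fun x => ∫ y, G (Function.update y i x)
      ∂(Measure.pi fun j => (ρ j : Measure (X j))) :=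
  (hG.comp (measurable_update' (X := X) (a := i))).stronglyMeasurable.integral_prod_left'.measurable

theorem abs_integral_le_of_bound {Ω : Type*} [MeasurableSpace Ω] (μ : Measure Ω)
    [IsProbabilityMeasure μ] {h : Ω → ℝ} {C : ℝ} (hC : ∀ x, |h x| ≤ C) : |∫ x, h x ∂μ| ≤ C := by
  simpa using norm_integral_le_of_norm_le_const (μ := μ) (f := h) (.of_forall hC)

theorem stmt_9
    {d : ℕ} (X : Fin d → Type) [∀ j, TopologicalSpace (X j)] [∀ j, PolishSpace (X j)]
    [∀ j, MeasurableSpace (X j)] [∀ j, BorelSpace (X j)]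
    (i : Fin d) (ρ : ∀ j, ProbabilityMeasure (X j))
    (Ni : ℕ) (φ : Fin Ni → X i → ℝ)
    (hφm : ∀ j, Measurable (φ j)) (hφb : ∀ j, ∃ C : ℝ, ∀ x, |φ j x| ≤ C)
    (G : (∀ j, X j) → ℝ) (hGm : Measurable G) (hGb : ∃ C : ℝ, ∀ x, |G x| ≤ C)
    (A : Set (ProbabilityMeasure (X i)))
    (hA : A = {μ : ProbabilityMeasure (X i) | ∀ j, ∫ x, φ j x ∂(μ : Measure (X i)) ≤ 0})
    (Δ : Set (ProbabilityMeasure (X i)))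
    (hΔ : Δ = {μ ∈ A | ∃ (ω : Fin (Ni + 2) → ℝ≥0∞) (x : Fin (Ni + 2) → X i),
        ∑ k, ω k = 1 ∧ (μ : Measure (X i)) = ∑ k, ω k • Measure.dirac (x k)})
    (g : X i → ℝ)
    (hg : g = fun xi => ∫ y, G (Function.update y i xi)
        ∂(Measure.pi fun j => (ρ j : Measure (X j))))
    (Si : ProbabilityMeasure (X i) → ℝ)
    (hSi : Si = fun μi : ProbabilityMeasure (X i) =>
      ((∫ xi, g xi ^ 2 ∂(μi : Measure (X i))) -
        (∫ y, G y ∂(Measure.pi fun j => (Function.update ρ i μi j : Measure (X j)))) ^ 2) /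
      ((∫ y, G y ^ 2 ∂(Measure.pi fun j => (Function.update ρ i μi j : Measure (X j)))) -
        (∫ y, G y ∂(Measure.pi fun j => (Function.update ρ i μi j : Measure (X j)))) ^ 2))
    (hvar : ∀ μi ∈ A,
      0 < (∫ y, G y ^ 2 ∂(Measure.pi fun j => (Function.update ρ i μi j : Measure (X j)))) -
        (∫ y, G y ∂(Measure.pi fun j => (Function.update ρ i μi j : Measure (X j)))) ^ 2) :
    (⨆ μi ∈ A, (Si μi : EReal)) = (⨆ μi ∈ Δ, (Si μi : EReal)) ∧
    (⨅ μi ∈ A, (Si μi : EReal)) = (⨅ μi ∈ Δ, (Si μi : EReal)) := by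
  obtain ⟨C, hC⟩ := hGb
  have hC2 : ∀ x, |G x ^ 2| ≤ C ^ 2 := fun x => by
    rw [abs_pow]; exact pow_le_pow_left₀ (abs_nonneg _) (hC x) 2
  have hG2m : Measurable fun x => G x ^ 2 := hGm.pow_const 2
  have hgm : Measurable g := hg ▸ measurable_integral_update ρ i hGm
  have hgb : ∀ x, |g x| ≤ C := fun x => hg ▸ abs_integral_le_of_bound _ fun _ => hC _
  let h : X i → ℝ := fun x => ∫ y, G (Function.update y i x) ^ 2
    ∂(Measure.pi fun j => (ρ j : Measure (X j)))
  have hhm : Measurable h := measurable_integral_update ρ i hG2m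
  have hhb : ∀ x, |h x| ≤ C ^ 2 := fun x => abs_integral_le_of_bound _ fun _ => hC2 _
  have hgi (μ : ProbabilityMeasure (X i)) : Integrable g (μ : Measure (X i)) :=
    .of_bound hgm.aestronglyMeasurable C (.of_forall hgb)
  have hg2i (μ : ProbabilityMeasure (X i)) : Integrable (fun x => g x ^ 2) (μ : Measure (X i)) :=
    .of_bound (hgm.pow_const 2).aestronglyMeasurable (C ^ 2) (.of_forall fun x => by
      rw [Real.norm_eq_abs, abs_pow]; exact pow_le_pow_left₀ (abs_nonneg _) (hgb x) 2)
  have hhi (μ : ProbabilityMeasure (X i)) : Integrable h (μ : Measure (X i)) :=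
    .of_bound hhm.aestronglyMeasurable (C ^ 2) (.of_forall hhb)
  have hφi (μ : ProbabilityMeasure (X i)) (j) : Integrable (φ j) (μ : Measure (X i)) := by
    obtain ⟨D, hD⟩ := hφb j
    exact .of_bound (hφm j).aestronglyMeasurable D (.of_forall hD)
  have hmean (μ : ProbabilityMeasure (X i)) :
      ∫ y, G y ∂(Measure.pi fun j => (Function.update ρ i μ j : Measure (X j))) =
        ∫ x, g x ∂(μ : Measure (X i)) := by
    rw [hg]; exact integral_pi_update ρ i μ hGm hC
  have hsecond (μ : ProbabilityMeasure (X i)) :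
      ∫ y, G y ^ 2 ∂(Measure.pi fun j => (Function.update ρ i μ j : Measure (X j))) =
        ∫ x, h x ∂(μ : Measure (X i)) :=
    integral_pi_update ρ i μ hG2m hC2
  simp only [hmean, hsecond] at hSi hvar
  have hSmul : ∀ μ ∈ A, Si μ * (∫ x, h x ∂(μ : Measure (X i)) -
      (∫ x, g x ∂(μ : Measure (X i))) ^ 2) =
      ∫ x, g x ^ 2 ∂(μ : Measure (X i)) - (∫ x, g x ∂(μ : Measure (X i))) ^ 2 := fun μ hμ => by
    rw [hSi]; exact div_mul_cancel₀ _ (hvar μ hμ).ne'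
  have hΔA : Δ ⊆ A := hΔ ▸ Set.sep_subset _ _
  have hreduce {f : X i → ℝ} {μ : ProbabilityMeasure (X i)} (hμ : μ ∈ A)
      (hf : Integrable f (μ : Measure (X i))) :
      ∃ ν ∈ Δ, ∫ x, g x ∂(ν : Measure (X i)) = ∫ x, g x ∂(μ : Measure (X i)) ∧
        ∫ x, f x ∂(μ : Measure (X i)) ≤ ∫ x, f x ∂(ν : Measure (X i)) := by
    obtain ⟨ω, x, hω, heq, hle⟩ := exists_sum_dirac_integral_eq_and_le (μ : Measure (X i))
      (ψ := (Fin.cons g φ : Fin (Ni + 1) → X i → ℝ))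
      (fun j => Fin.cases (hgi μ) (fun j => hφi μ j) j) hf
    let ν : ProbabilityMeasure (X i) := ⟨∑ k, ω k • Measure.dirac (x k), ⟨by simp [hω]⟩⟩
    refine ⟨ν, ?_, heq 0, hle⟩
    rw [hΔ]
    refine ⟨?_, ω, x, hω, rfl⟩
    rw [hA] at hμ ⊢
    exact fun j => (heq j.succ).trans_le (hμ j)
  refine ⟨le_antisymm (iSup₂_le fun μ hμ => ?_) (biSup_mono fun μ hμ => hΔA hμ),
    le_antisymm (biInf_mono fun μ hμ => hΔA hμ) (le_iInf₂ fun μ hμ => ?_)⟩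
  · have hs := hSmul μ hμ
    obtain ⟨ν, hν, hνg, hνf⟩ := hreduce hμ ((hg2i μ).sub ((hhi μ).const_mul (Si μ)))
    refine le_iSup₂_of_le ν hν (EReal.coe_le_coe_iff.2 ?_)
    have hpos := hvar ν (hΔA hν)
    simp only [Pi.sub_apply] at hνf
    rw [integral_sub (hg2i μ) ((hhi μ).const_mul _), integral_sub (hg2i ν) ((hhi ν).const_mul _),
      integral_const_mul, integral_const_mul] at hνf
    rw [show Si ν = _ from congrFun hSi ν, le_div_iff₀ hpos, hνg]
    linarith
  · have hs := hSmul μ hμ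
    obtain ⟨ν, hν, hνg, hνf⟩ := hreduce hμ (((hhi μ).const_mul (Si μ)).sub (hg2i μ))
    refine iInf₂_le_of_le ν hν (EReal.coe_le_coe_iff.2 ?_)
    have hpos := hvar ν (hΔA hν)
    simp only [Pi.sub_apply] at hνf
    rw [integral_sub ((hhi μ).const_mul _) (hg2i μ), integral_sub ((hhi ν).const_mul _) (hg2i ν),
      integral_const_mul, integral_const_mul] at hνf
    rw [show Si ν = _ from congrFun hSi ν, div_le_iff₀ hpos, hνg]
    linarith
end
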